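/- Let d be a positive squarefree integer with d ≡ 3 (mod 4) and n ≥ 1. Let O = ℤ[ω] where ω = (1+√-d)/2 satisfies ω² = ω - (1+d)/4, with conjugation the ring automorphism σ determined by σ(ω) = 1-ω. Then there exists k₀ such that for all k ≥ k₀, with R = O/(2^k), σ the induced endomorphism, and M = diag(1,…,1,-2) of size n+1, the number of matrices A ∈ M_{n+1}(R) with A·M·σ(A)ᵀ = M equals 2^k·(2 - χ₈(-d)) times the number of such matrices that in addition satisfy det A = 1, where χ₈(m) = 1 if m ≡ ±1 (mod 8) and χ₈(m) = -1 if m ≡ ±3 (mod 8). -/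

import Mathlib

open Matrix Polynomial

/-- The ring `O = ℤ[ω]` where `ω = (1+√-d)/2` satisfies `ω² = ω - (1+d)/4`,
realized as `ℤ[X]/(X² - X + (1+d)/4)`. -/
abbrev Og (d : ℤ) : Type := AdjoinRoot (X ^ 2 - X + C ((1 + d) / 4) : ℤ[X])

/-- Conjugation on `O = ℤ[ω]`, the ring endomorphism determined by `ω ↦ 1 - ω`. -/
noncomputable def conjOg (d : ℤ) : Og d →+* Og d :=
  AdjoinRoot.lift (AdjoinRoot.of _) (1 - AdjoinRoot.root _)
    (by
      have h := AdjoinRoot.eval₂_root (X ^ 2 - X + C ((1 + d) / 4) : ℤ[X])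
      simp only [Polynomial.eval₂_add, Polynomial.eval₂_sub, Polynomial.eval₂_pow,
        Polynomial.eval₂_X, Polynomial.eval₂_C] at h ⊢
      linear_combination h)

/-- The quotient ring `O/(m)`. -/
abbrev ROg (d m : ℤ) : Type := Og d ⧸ Ideal.span {(m : Og d)}

/-- Conjugation descends to the quotient `O/(m)`. -/
noncomputable def conjROg (d m : ℤ) : ROg d m →+* ROg d m :=
  Ideal.quotientMap (Ideal.span {(m : Og d)}) (conjOg d)
    (by
      rw [Ideal.span_singleton_le_iff_mem, Ideal.mem_comap, map_intCast]
      exact Ideal.mem_span_singleton_self _)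

/-- The diagonal matrix `diag(1, …, 1, -2)` of size `n+1`. -/
def Mmat (R : Type*) [Ring R] (n : ℕ) : Matrix (Fin (n + 1)) (Fin (n + 1)) R :=
  Matrix.diagonal fun i => if i = Fin.last n then -2 else 1

section residues
variable {Z : Type*} [CommRing Z] [Fintype Z]

lemma card_filter_map_eq_zero_eq_one (π : Z →+* ZMod 2) :
    (Finset.univ.filter fun x => π x = 1).card = (Finset.univ.filter fun x => π x = 0).card := by
  refine Finset.card_bij' (fun x _ => x - 1) (fun x _ => x + 1) ?_ ?_ ?_ ?_ <;>
    simp +contextual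

lemma zmod_two_cases (x : ZMod 2) : x = 0 ∨ x = 1 := by
  revert x; decide

lemma card_eq_two_mul_card_filter (π : Z →+* ZMod 2) :
    Fintype.card Z = 2 * (Finset.univ.filter fun x => π x = 0).card := by
  have h := Finset.card_filter_add_card_filter_not (s := (Finset.univ : Finset Z)) (fun x => π x = 0)
  have h2 : (Finset.univ.filter fun x => ¬ π x = 0) = Finset.univ.filter fun x => π x = 1 := by
    ext x
    rcases zmod_two_cases (π x) with h | h <;> simp [h]
  rw [h2, card_filter_map_eq_zero_eq_one, Finset.card_univ] at h
  omega

lemma card_filter_map_eq (π : Z →+* ZMod 2) (x : ZMod 2) :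
    (Finset.univ.filter fun z => π z = x).card = (Finset.univ.filter fun z => π z = 0).card := by
  rcases zmod_two_cases x with rfl | rfl
  · rfl
  · exact card_filter_map_eq_zero_eq_one π

/-- A map between residue classes modulo `2` that is injective on its source class is bijective. -/
lemma exists_mem_class_eq (π : Z →+* ZMod 2) (f : Z → Z) (x y : ZMod 2)
    (hf : ∀ z, π z = x → π (f z) = y)
    (hinj : ∀ z w, π z = x → π w = x → f z = f w → z = w) (t : Z) (ht : π t = y) :
    ∃ z, π z = x ∧ f z = t := by
  have h := Finset.surjOn_of_injOn_of_card_le (s := Finset.univ.filter fun z => π z = x)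
    (t := Finset.univ.filter fun z => π z = y) f
    (fun z hz => by simpa using hf z (by simpa using hz))
    (fun z hz w hw h => hinj z w (by simpa using hz) (by simpa using hw) h)
    (by rw [card_filter_map_eq π x, card_filter_map_eq π y])
  obtain ⟨z, hz, rfl⟩ := h (show t ∈ _ by simpa using ht)
  exact ⟨z, by simpa using hz, rfl⟩

lemma card_norm_form_eq_fst [DecidableEq Z]  (π : Z →+* ZMod 2) (hπ : ∀ x, π x = 1 → IsUnit x) (c r : Z)
    (hr : π r = 1) :
    (Finset.univ.filter fun p : Z × Z =>
      p.1 ^ 2 + p.1 * p.2 + c * p.2 ^ 2 = r ∧ π p.2 = 0).card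
      = (Finset.univ.filter fun x => π x = 0).card := by
  rw [← card_filter_map_eq π 1]
  have inj : ∀ a z w, π a = 1 → π z = 0 → π w = 0 →
      a ^ 2 + a * z + c * z ^ 2 = a ^ 2 + a * w + c * w ^ 2 → z = w := by
    intro a z w ha hz hw h
    have hu : IsUnit (a + c * (z + w)) := hπ _ (by simp [ha, hz, hw])
    have : (z - w) * (a + c * (z + w)) = 0 := by linear_combination h
    exact sub_eq_zero.mp (hu.mul_left_eq_zero.mp this)
  have odd : ∀ p : Z × Z, p.1 ^ 2 + p.1 * p.2 + c * p.2 ^ 2 = r → π p.2 = 0 → π p.1 = 1 := by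
    intro p h h2
    have := congrArg π h
    simp only [map_add, map_mul, map_pow, h2, hr] at this
    rcases zmod_two_cases (π p.1) with h | h
    · simp [h] at this
    · exact h
  refine Finset.card_nbij Prod.fst ?_ ?_ ?_
  · intro p hp
    simp only [Finset.coe_filter, Finset.mem_univ, true_and, Set.mem_ofPred_eq] at hp ⊢
    exact odd p hp.1 hp.2
  · rintro ⟨a, z⟩ hp ⟨b, w⟩ hq h
    simp only [Finset.coe_filter, Finset.mem_univ, true_and, Set.mem_ofPred_eq] at hp hq h
    subst h
    rw [inj a z w (odd (a, z) hp.1 hp.2) hp.2 hq.2 (hp.1.trans hq.1.symm)]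
  · intro a ha
    simp only [Finset.coe_filter, Finset.mem_univ, true_and, Set.mem_ofPred_eq] at ha
    obtain ⟨z, hz, h⟩ := exists_mem_class_eq π (fun z => a ^ 2 + a * z + c * z ^ 2) 0 1
      (fun z hz => by simp [ha, hz]) (fun z w hz hw => inj a z w ha hz hw) r hr
    exact ⟨(a, z), by simpa using ⟨h, hz⟩, rfl⟩

lemma card_norm_form_eq_snd [DecidableEq Z]  (π : Z →+* ZMod 2) (hπ : ∀ x, π x = 1 → IsUnit x) (c r : Z)
    (hr : π r = 1) (hc : π c = 1) (x : ZMod 2) :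
    (Finset.univ.filter fun p : Z × Z =>
      p.1 ^ 2 + p.1 * p.2 + c * p.2 ^ 2 = r ∧ π p.2 = 1 ∧ π p.1 = x).card
      = (Finset.univ.filter fun x => π x = 0).card := by
  rw [← card_filter_map_eq π 1]
  have inj : ∀ b z w, π b = 1 → π z = x → π w = x →
      z ^ 2 + z * b + c * b ^ 2 = w ^ 2 + w * b + c * b ^ 2 → z = w := by
    intro b z w hb hz hw h
    have hu : IsUnit (z + w + b) := hπ _ (by
      simp [hb, hz, hw, CharTwo.add_self_eq_zero])
    have : (z - w) * (z + w + b) = 0 := by linear_combination h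
    exact sub_eq_zero.mp (hu.mul_left_eq_zero.mp this)
  refine Finset.card_nbij Prod.snd ?_ ?_ ?_
  · intro p hp
    simp only [Finset.coe_filter, Finset.mem_univ, true_and, Set.mem_ofPred_eq] at hp ⊢
    exact hp.2.1
  · rintro ⟨z, a⟩ hp ⟨w, b⟩ hq h
    simp only [Finset.coe_filter, Finset.mem_univ, true_and, Set.mem_ofPred_eq] at hp hq h
    subst h
    rw [inj a z w hp.2.1 hp.2.2 hq.2.2 (hp.1.trans hq.1.symm)]
  · intro b hb
    simp only [Finset.coe_filter, Finset.mem_univ, true_and, Set.mem_ofPred_eq] at hb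
    obtain ⟨z, hz, h⟩ := exists_mem_class_eq π (fun z => z ^ 2 + z * b + c * b ^ 2) x 1
      (fun z hz => by
        simp only [map_add, map_mul, map_pow, hz, hb, hc]
        rcases zmod_two_cases x with rfl | rfl <;> decide)
      (fun z w hz hw => inj b z w hb hz hw) r hr
    exact ⟨(z, b), by simpa using ⟨h, hb, hz⟩, rfl⟩

/-- The number of representations of an odd `r` by the form `a² + ab + cb²`. -/
lemma card_norm_form_eq [DecidableEq Z] (π : Z →+* ZMod 2) (hπ : ∀ x, π x = 1 → IsUnit x) (c r : Z)
    (hr : π r = 1) :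
    2 * (Finset.univ.filter fun p : Z × Z => p.1 ^ 2 + p.1 * p.2 + c * p.2 ^ 2 = r).card
      = (if π c = 1 then 3 else 1) * Fintype.card Z := by
  rw [card_eq_two_mul_card_filter π]
  have h0 := card_norm_form_eq_fst π hπ c r hr
  have hsplit := Finset.card_filter_add_card_filter_not
    (s := Finset.univ.filter fun p : Z × Z => p.1 ^ 2 + p.1 * p.2 + c * p.2 ^ 2 = r)
    (fun p => π p.2 = 0)
  rw [Finset.filter_filter, Finset.filter_filter, h0] at hsplit
  have key : ∀ x : ZMod 2, ¬ x = 0 ↔ x = 1 := by decide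
  simp only [key] at hsplit
  rw [← hsplit]
  split_ifs with hc
  · have hsplit2 := Finset.card_filter_add_card_filter_not
      (s := Finset.univ.filter fun p : Z × Z =>
        p.1 ^ 2 + p.1 * p.2 + c * p.2 ^ 2 = r ∧ π p.2 = 1) (fun p => π p.1 = 0)
    simp only [Finset.filter_filter, key, and_assoc] at hsplit2
    rw [card_norm_form_eq_snd π hπ c r hr hc 0, card_norm_form_eq_snd π hπ c r hr hc 1] at hsplit2
    omega
  · have hc0 : π c = 0 := (zmod_two_cases _).resolve_right hc
    have hempty : (Finset.univ.filter fun p : Z × Z =>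
        p.1 ^ 2 + p.1 * p.2 + c * p.2 ^ 2 = r ∧ π p.2 = 1) = ∅ := by
      refine Finset.filter_false_of_mem ?_
      rintro p - ⟨h, h1⟩
      have := congrArg π h
      simp only [map_add, map_mul, map_pow, h1, hc0, hr] at this
      rcases zmod_two_cases (π p.1) with h | h <;> simp [h, CharTwo.add_self_eq_zero] at this
    rw [hempty, Finset.card_empty, add_zero, one_mul]
end residues

section zmod

lemma two_dvd_two_pow {k : ℕ} (hk : 2 ≤ k) : 2 ∣ 2 ^ k := dvd_pow_self 2 (by omega)

lemma isUnit_of_castHom_eq_one {k : ℕ} (h : 2 ∣ 2 ^ k) (x : ZMod (2 ^ k))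
    (hx : ZMod.castHom h (ZMod 2) x = 1) : IsUnit x := by
  obtain ⟨z, rfl⟩ := ZMod.natCast_zmod_surjective x
  rw [map_natCast, ← Nat.cast_one, ZMod.natCast_eq_natCast_iff] at hx
  rw [ZMod.isUnit_iff_coprime]
  exact Nat.Coprime.pow_right k (Nat.odd_iff.mpr hx).coprime_two_right

lemma two_mul_eq_two_iff {k : ℕ} (hk : 2 ≤ k) (x : ZMod (2 ^ k)) :
    2 * x = 2 ↔ x = 1 ∨ x = 1 + 2 ^ (k - 1) := by
  obtain ⟨j, rfl⟩ := Nat.exists_eq_add_of_le' hk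
  have h2 : (2 : ZMod (2 ^ (j + 2))) * 2 ^ (j + 1) = 0 := by
    have := ZMod.natCast_self (2 ^ (j + 2))
    push_cast at this
    rw [← this]
    ring
  constructor
  · intro h
    obtain ⟨z, rfl⟩ := ZMod.intCast_surjective x
    have h' : ((2 * (z - 1) : ℤ) : ZMod (2 ^ (j + 2))) = 0 := by
      push_cast
      linear_combination h
    rw [ZMod.intCast_zmod_eq_zero_iff_dvd] at h'
    push_cast at h'
    have h3 : (2 : ℤ) ^ (j + 1) ∣ z - 1 := by
      rw [show (2 : ℤ) ^ (j + 2) = 2 * 2 ^ (j + 1) by ring] at h'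
      exact (mul_dvd_mul_iff_left two_ne_zero).mp h'
    obtain ⟨w, hw⟩ := h3
    rw [show z = 1 + 2 ^ (j + 1) * w by linarith]
    obtain ⟨v, rfl | rfl⟩ := w.even_or_odd'
    · left
      push_cast
      linear_combination (v : ZMod (2 ^ (j + 2))) * h2
    · right
      push_cast
      linear_combination (v : ZMod (2 ^ (j + 2))) * h2
  · rintro (rfl | rfl)
    · ring
    · rw [Nat.add_succ_sub_one]
      linear_combination h2

lemma castHom_one_add_two_pow {k : ℕ} (hk : 2 ≤ k) :
    ZMod.castHom (two_dvd_two_pow hk) (ZMod 2) (1 + 2 ^ (k - 1)) = 1 := by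
  have h : (2 : ZMod 2) = 0 := rfl
  simp only [map_add, map_one, map_pow, map_ofNat, h]
  rw [zero_pow (by omega), add_zero]

/-- The number of solutions of `2 (a² + ab + cb²) = 2` modulo `2 ^ k`. -/
lemma card_two_mul_norm_form_eq {k : ℕ} (hk : 2 ≤ k) (c : ℤ) :
    Nat.card {p : ZMod (2 ^ k) × ZMod (2 ^ k) //
      2 * (p.1 ^ 2 + p.1 * p.2 + (c : ZMod (2 ^ k)) * p.2 ^ 2) = 2}
      = (if (c : ZMod 2) = 1 then 3 else 1) * 2 ^ k := by
  have hd := two_dvd_two_pow hk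
  set π := ZMod.castHom hd (ZMod 2)
  have hπ := isUnit_of_castHom_eq_one hd
  have hr : π (1 + 2 ^ (k - 1)) = 1 := castHom_one_add_two_pow hk
  have h1 := card_norm_form_eq π hπ c 1 (map_one π)
  have h2 := card_norm_form_eq π hπ c _ hr
  rw [ZMod.card, map_intCast] at h1 h2
  simp only [two_mul_eq_two_iff hk]
  rw [Nat.card_eq_fintype_card, Fintype.card_subtype, Finset.filter_or,
    Finset.card_union_of_disjoint]
  · omega
  · rw [Finset.disjoint_filter]
    intro p _ h h'
    rw [h] at h'
    have h0 : (2 : ZMod (2 ^ k)) ^ (k - 1) = 0 := by linear_combination -h'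
    have : ((2 ^ (k - 1) : ℕ) : ZMod (2 ^ k)) = 0 := by exact_mod_cast h0
    rw [ZMod.natCast_eq_zero_iff, Nat.pow_dvd_pow_iff_le_right (by norm_num)] at this
    omega

end zmod

section unitary
variable {R : Type*} [CommRing R] (σ : R →+* R) (n : ℕ)

lemma two_mul_det_mul_map_det {A : Matrix (Fin (n + 1)) (Fin (n + 1)) R}
    (hA : A * Mmat R n * (A.map σ)ᵀ = Mmat R n) : 2 * (A.det * σ A.det) = 2 := by
  have h := congrArg Matrix.det hA
  have hM : (Mmat R n).det = -2 := by
    rw [Mmat, Matrix.det_diagonal, Fin.prod_univ_castSucc]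
    simp [Fin.castSucc_ne_last]
  rw [Matrix.det_mul, Matrix.det_mul, Matrix.det_transpose, hM] at h
  have h2 : (A.map σ).det = σ A.det := (RingHom.map_det σ A).symm
  rw [h2] at h
  linear_combination -h

/-- The matrix `diag(1, …, 1, u)`. -/
def diagLast (u : R) : Matrix (Fin (n + 1)) (Fin (n + 1)) R :=
  Matrix.diagonal fun i => if i = Fin.last n then u else 1

lemma det_diagLast (u : R) : (diagLast n u).det = u := by
  rw [diagLast, Matrix.det_diagonal, Fin.prod_univ_castSucc]
  simp [Fin.castSucc_ne_last]

lemma diagLast_mul_diagLast (u v : R) : diagLast n u * diagLast n v = diagLast n (u * v) := by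
  rw [diagLast, diagLast, diagLast, Matrix.diagonal_mul_diagonal]
  congr 1
  ext i
  split_ifs <;> simp

lemma diagLast_one : diagLast n (1 : R) = 1 := by
  simp [diagLast]

lemma diagLast_mul_unitary {u : R} (hu : 2 * (u * σ u) = 2)
    {A : Matrix (Fin (n + 1)) (Fin (n + 1)) R} (hA : A * Mmat R n * (A.map σ)ᵀ = Mmat R n) :
    (diagLast n u * A) * Mmat R n * ((diagLast n u * A).map σ)ᵀ = Mmat R n := by
  have hmap : (diagLast n u).map σ = diagLast n (σ u) := by
    rw [diagLast, diagLast, Matrix.diagonal_map (map_zero σ)]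
    congr 1
    ext i
    simp [apply_ite σ]
  have htr : (diagLast n (σ u))ᵀ = diagLast n (σ u) := Matrix.diagonal_transpose _
  calc _ = diagLast n u * (A * Mmat R n * (A.map σ)ᵀ) * diagLast n (σ u) := by
        rw [Matrix.map_mul, Matrix.transpose_mul, hmap, htr]
        simp only [Matrix.mul_assoc]
    _ = Mmat R n := by
        rw [hA, diagLast, diagLast, Mmat, Matrix.diagonal_mul_diagonal,
          Matrix.diagonal_mul_diagonal]
        congr 1
        ext i
        split_ifs
        · linear_combination -hu
        · simp

lemma card_unitary_eq_mul (hunit : ∀ u : R, 2 * (u * σ u) = 2 → IsUnit u) :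
    Nat.card {A : Matrix (Fin (n + 1)) (Fin (n + 1)) R //
        A * Mmat R n * (A.map σ)ᵀ = Mmat R n}
      = Nat.card {u : R // 2 * (u * σ u) = 2} *
        Nat.card {A : Matrix (Fin (n + 1)) (Fin (n + 1)) R //
          A * Mmat R n * (A.map σ)ᵀ = Mmat R n ∧ A.det = 1} := by
  rw [← Nat.card_prod]
  symm
  refine Nat.card_congr (Equiv.ofBijective (fun p => ⟨diagLast n p.1.1 * p.2.1,
    diagLast_mul_unitary σ n p.1.2 p.2.2.1⟩) ⟨?_, ?_⟩)
  · rintro ⟨⟨u, hu⟩, ⟨A, hA, hA1⟩⟩ ⟨⟨v, hv⟩, ⟨B, hB, hB1⟩⟩ h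
    have h' : diagLast n u * A = diagLast n v * B := congrArg Subtype.val h
    have hdet := congrArg Matrix.det h'
    rw [Matrix.det_mul, Matrix.det_mul, det_diagLast, det_diagLast, hA1, hB1, mul_one,
      mul_one] at hdet
    subst hdet
    obtain ⟨w, hw⟩ := (hunit u hu).exists_left_inv
    have h2 := congrArg (diagLast n w * ·) h'
    simp only [← Matrix.mul_assoc, diagLast_mul_diagLast, hw, diagLast_one, Matrix.one_mul] at h2
    subst h2
    rfl
  · rintro ⟨A, hA⟩
    have hu := two_mul_det_mul_map_det σ n hA
    obtain ⟨w, hw⟩ := (hunit _ hu).exists_left_inv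
    have hσ : σ w * σ A.det = 1 := by rw [← map_mul, hw, map_one]
    have hw2 : 2 * (w * σ w) = 2 := by
      linear_combination (-(w * σ w)) * hu + 2 * hw * (σ w * σ A.det) + 2 * hσ
    refine ⟨⟨⟨A.det, hu⟩, ⟨diagLast n w * A, diagLast_mul_unitary σ n hw2 hA, ?_⟩⟩, ?_⟩
    · rw [Matrix.det_mul, det_diagLast, hw]
    · apply Subtype.ext
      simp only [← Matrix.mul_assoc, diagLast_mul_diagLast, mul_comm _ w, hw, diagLast_one,
        Matrix.one_mul]

end unitary

section og

lemma root_sq_sub_root_add (d : ℤ) :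
    (AdjoinRoot.root _ : Og d) ^ 2 - AdjoinRoot.root _ + (((1 + d) / 4 : ℤ) : Og d) = 0 := by
  have h := AdjoinRoot.eval₂_root (X ^ 2 - X + C ((1 + d) / 4) : ℤ[X])
  simp only [Polynomial.eval₂_add, Polynomial.eval₂_sub, Polynomial.eval₂_pow,
    Polynomial.eval₂_X, Polynomial.eval₂_C] at h
  rwa [eq_intCast] at h

lemma exists_eq_add_mul_root (d : ℤ) (x : Og d) :
    ∃ a b : ℤ, x = (a : Og d) + (b : Og d) * (AdjoinRoot.root _ : Og d) := by
  have hroot := root_sq_sub_root_add d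
  induction x using AdjoinRoot.induction_on with | ih p =>
  induction p using Polynomial.induction_on with
  | C a => exact ⟨a, 0, by rw [AdjoinRoot.mk_C, eq_intCast, Int.cast_zero, zero_mul, add_zero]⟩
  | add p q hp hq =>
    obtain ⟨a, b, h⟩ := hp
    obtain ⟨a', b', h'⟩ := hq
    refine ⟨a + a', b + b', ?_⟩
    rw [map_add, h, h']
    push_cast
    ring
  | monomial m a h =>
    obtain ⟨a', b', h'⟩ := h
    refine ⟨-b' * ((1 + d) / 4), a' + b', ?_⟩
    rw [pow_succ (n := m), ← mul_assoc, map_mul, h', AdjoinRoot.mk_X]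
    push_cast
    linear_combination (b' : Og d) * hroot

/-- Reduction of `ℤ[ω]` modulo `m` in coordinates. -/
noncomputable def ogToQuadratic (d : ℤ) (m : ℕ) :
    Og d →+* QuadraticAlgebra (ZMod m) (-(((1 + d) / 4 : ℤ) : ZMod m)) 1 :=
  AdjoinRoot.lift (Int.castRingHom _) QuadraticAlgebra.omega (by
    simp only [Polynomial.eval₂_add, Polynomial.eval₂_sub, Polynomial.eval₂_pow,
      Polynomial.eval₂_X, Polynomial.eval₂_C]
    ext <;> simp [sq])

lemma ogToQuadratic_apply (d : ℤ) (m : ℕ) (a b : ℤ) :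
    ogToQuadratic d m ((a : Og d) + (b : Og d) * (AdjoinRoot.root _ : Og d))
      = ⟨(a : ZMod m), (b : ZMod m)⟩ := by
  rw [map_add, map_mul, map_intCast, map_intCast, ogToQuadratic, AdjoinRoot.lift_root]
  ext <;> simp

/-- The ring `O/(2 ^ k)` in coordinates. -/
noncomputable def rogToQuadratic (d : ℤ) (k : ℕ) :
    ROg d (2 ^ k) →+* QuadraticAlgebra (ZMod (2 ^ k)) (-(((1 + d) / 4 : ℤ) : ZMod (2 ^ k))) 1 :=
  Ideal.Quotient.lift _ (ogToQuadratic d (2 ^ k)) (by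
    intro a ha
    obtain ⟨b, rfl⟩ := Ideal.mem_span_singleton'.mp ha
    have h : ((2 ^ k : ℤ) : ZMod (2 ^ k)) = 0 := by
      exact_mod_cast ZMod.natCast_self (2 ^ k)
    rw [map_mul, map_intCast]
    have h' : ((2 ^ k : ℤ) : QuadraticAlgebra (ZMod (2 ^ k))
        (-(((1 + d) / 4 : ℤ) : ZMod (2 ^ k))) 1) = 0 := by
      rw [← QuadraticAlgebra.C_intCast, h, QuadraticAlgebra.C_zero]
    rw [h', mul_zero])

lemma rogToQuadratic_mk (d : ℤ) (k : ℕ) (a b : ℤ) :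
    rogToQuadratic d k (Ideal.Quotient.mk _
      ((a : Og d) + (b : Og d) * (AdjoinRoot.root _ : Og d)))
      = ⟨(a : ZMod (2 ^ k)), (b : ZMod (2 ^ k))⟩ := by
  rw [rogToQuadratic, Ideal.Quotient.lift_mk, ogToQuadratic_apply]

lemma rogToQuadratic_bijective (d : ℤ) (k : ℕ) : Function.Bijective (rogToQuadratic d k) := by
  constructor
  · rw [injective_iff_map_eq_zero]
    intro x hx
    obtain ⟨y, rfl⟩ := Ideal.Quotient.mk_surjective x
    obtain ⟨a, b, rfl⟩ := exists_eq_add_mul_root d y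
    rw [rogToQuadratic_mk, QuadraticAlgebra.ext_iff] at hx
    obtain ⟨ha, hb⟩ := hx
    simp only [QuadraticAlgebra.re_zero, QuadraticAlgebra.im_zero] at ha hb
    rw [ZMod.intCast_zmod_eq_zero_iff_dvd] at ha hb
    obtain ⟨a, rfl⟩ := ha
    obtain ⟨b, rfl⟩ := hb
    rw [Ideal.Quotient.eq_zero_iff_mem, Ideal.mem_span_singleton']
    refine ⟨(a : Og d) + (b : Og d) * (AdjoinRoot.root _ : Og d), ?_⟩
    push_cast
    ring
  · rintro ⟨a, b⟩
    obtain ⟨a, rfl⟩ := ZMod.intCast_surjective a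
    obtain ⟨b, rfl⟩ := ZMod.intCast_surjective b
    exact ⟨_, rogToQuadratic_mk d k a b⟩

lemma rogToQuadratic_conj (d : ℤ) (k : ℕ) (x : ROg d (2 ^ k)) :
    rogToQuadratic d k (conjROg d (2 ^ k) x) = star (rogToQuadratic d k x) := by
  obtain ⟨y, rfl⟩ := Ideal.Quotient.mk_surjective x
  obtain ⟨a, b, rfl⟩ := exists_eq_add_mul_root d y
  have hconj : conjOg d ((a : Og d) + (b : Og d) * (AdjoinRoot.root _ : Og d))
      = ((a + b : ℤ) : Og d) + ((-b : ℤ) : Og d) * (AdjoinRoot.root _ : Og d) := by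
    rw [map_add, map_mul, map_intCast, map_intCast, conjOg, AdjoinRoot.lift_root]
    push_cast
    ring
  rw [conjROg, Ideal.quotientMap_mk, hconj, rogToQuadratic_mk, rogToQuadratic_mk]
  ext <;> simp

lemma two_mul_mul_conj_eq_two_iff (d : ℤ) (k : ℕ) (u : ROg d (2 ^ k)) :
    2 * (u * conjROg d (2 ^ k) u) = 2 ↔ 2 * (rogToQuadratic d k u).norm = 2 := by
  rw [← (rogToQuadratic_bijective d k).1.eq_iff, map_mul, map_mul, rogToQuadratic_conj,
    ← QuadraticAlgebra.algebraMap_norm_eq_mul_star, map_ofNat,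
    ← (QuadraticAlgebra.algebraMap_injective (a := -(((1 + d) / 4 : ℤ) : ZMod (2 ^ k)))
      (b := 1)).eq_iff, map_mul, map_ofNat]

lemma isUnit_of_two_mul_mul_conj_eq_two (d : ℤ) {k : ℕ} (hk : 2 ≤ k) (u : ROg d (2 ^ k))
    (hu : 2 * (u * conjROg d (2 ^ k) u) = 2) : IsUnit u := by
  rw [two_mul_mul_conj_eq_two_iff, two_mul_eq_two_iff hk] at hu
  have hnorm : IsUnit (rogToQuadratic d k u).norm := by
    refine isUnit_of_castHom_eq_one (two_dvd_two_pow hk) _ ?_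
    rcases hu with h | h
    · rw [h, map_one]
    · rw [h]
      exact castHom_one_add_two_pow hk
  exact (isUnit_map_iff (RingEquiv.ofBijective _ (rogToQuadratic_bijective d k)) u).mp
    (QuadraticAlgebra.isUnit_iff_norm_isUnit.mpr hnorm)

lemma card_two_mul_mul_conj_eq_two (d : ℤ) {k : ℕ} (hk : 2 ≤ k) :
    Nat.card {u : ROg d (2 ^ k) // 2 * (u * conjROg d (2 ^ k) u) = 2}
      = (if (((1 + d) / 4 : ℤ) : ZMod 2) = 1 then 3 else 1) * 2 ^ k := by
  rw [← card_two_mul_norm_form_eq hk]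
  refine Nat.card_congr (((Equiv.ofBijective _ (rogToQuadratic_bijective d k)).trans
    (QuadraticAlgebra.equivProd _ _)).subtypeEquiv fun u => ?_)
  rw [two_mul_mul_conj_eq_two_iff, QuadraticAlgebra.norm_def]
  simp only [QuadraticAlgebra.equivProd, Equiv.trans_apply, Equiv.ofBijective_apply,
    Equiv.coe_fn_mk]
  ring_nf

lemma two_sub_χ₈_neg (d : ℤ) (hd4 : d % 4 = 3) :
    2 - ZMod.χ₈ ((-d : ℤ) : ZMod 8) = if (((1 + d) / 4 : ℤ) : ZMod 2) = 1 then 3 else 1 := by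
  have h : (((1 + d) / 4 : ℤ) : ZMod 2) = 1 ↔ (1 + d) / 4 % 2 = 1 := by
    rw [← Int.cast_one (R := ZMod 2), ZMod.intCast_eq_intCast_iff]
    rfl
  rw [ZMod.χ₈_int_eq_if_mod_eight]
  simp only [h]
  split_ifs <;> omega

end og

/-- Unramified index formula for `M` at `2`: for all sufficiently large `k`,
`#U(M, O/(2^k)) = 2^k·(2 - χ₈(-d)) · #SU(M, O/(2^k))`. -/
theorem card_U_M_eq_index_mul_card_SU_M_two_unramified (d : ℤ) (hd : 0 < d)
    (hsf : Squarefree d) (hd4 : d % 4 = 3) (n : ℕ) (hn : 1 ≤ n) :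
    ∃ k₀ : ℕ, ∀ k ≥ k₀,
      (Nat.card {A : Matrix (Fin (n + 1)) (Fin (n + 1)) (ROg d (2 ^ k)) //
          A * Mmat (ROg d (2 ^ k)) n * (A.map (conjROg d (2 ^ k)))ᵀ = Mmat (ROg d (2 ^ k)) n} : ℤ)
        = 2 ^ k * (2 - ZMod.χ₈ ((-d : ℤ) : ZMod 8)) *
          Nat.card {A : Matrix (Fin (n + 1)) (Fin (n + 1)) (ROg d (2 ^ k)) //
            A * Mmat (ROg d (2 ^ k)) n * (A.map (conjROg d (2 ^ k)))ᵀ = Mmat (ROg d (2 ^ k)) n ∧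
            A.det = 1} := by
  refine ⟨2, fun k hk => ?_⟩
  rw [card_unitary_eq_mul (conjROg d (2 ^ k)) n (isUnit_of_two_mul_mul_conj_eq_two d hk),
    card_two_mul_mul_conj_eq_two d hk, two_sub_χ₈_neg d hd4]
  push_cast
  ring
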